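/- Let G be an additive subgroup of ℝ, equipped with the subspace (Euclidean) topology, which is σ-compact, and let f : G → G be a strictly increasing (order-preserving) fixed-point free bijection. Then there exists a binary operation +_f on G such that (G, +_f) with the subspace topology is a topological group, there exists a map φ : G → G that is simultaneously a group isomorphism from (G, +) to (G, +_f) and a homeomorphism, and there exists an element c ∈ G, not the neutral element of +_f, such that f(x) = x +_f c for all x ∈ G. -/

import Mathlib

open Set Filter Topology TopologicalSpace

/-- A complete linear order with countably many jumps, any two of which are separated by a third
one and which occur between any two points, is the order of lower sets of `ℚ`. -/
theorem nonempty_orderIso_lowerSet_rat {E : Type*} [LinearOrder E] [Nontrivial E]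
    (hsup : ∀ S : Set E, ∃ x, IsLUB S x)
    (hjump : ∀ x y : E, x < y → ∃ l r, x ≤ l ∧ l ⋖ r ∧ r ≤ y)
    (hperf : ∀ a b c : E, a ⋖ b → ¬ b ⋖ c)
    (hbot : ∀ x y : E, IsBot x → ¬ x ⋖ y) (htop : ∀ x y : E, IsTop y → ¬ x ⋖ y)
    (hcount : {l : E | ∃ r, l ⋖ r}.Countable) : Nonempty (E ≃o LowerSet ℚ) := by
  let L := {l : E | ∃ r, l ⋖ r}
  obtain ⟨x₀, y₀, hxy⟩ := exists_pair_lt E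
  have : Countable L := hcount.to_subtype
  have : Nonempty L := by
    obtain ⟨l, r, -, h, -⟩ := hjump x₀ y₀ hxy
    exact ⟨⟨l, r, h⟩⟩
  have : DenselyOrdered L := by
    refine ⟨?_⟩
    rintro ⟨a, a', ha⟩ ⟨b, b', hb⟩ (hab : a < b)
    have h1 : a' < b := by
      refine lt_of_le_of_ne (not_lt.1 fun h => ha.2 hab h) ?_
      rintro rfl
      exact hperf _ _ _ ha hb
    obtain ⟨l, r, h2, h3, h4⟩ := hjump _ _ h1
    exact ⟨⟨l, r, h3⟩, ha.1.trans_le h2, h3.1.trans_le h4⟩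
  have : NoMinOrder L := by
    refine ⟨?_⟩
    rintro ⟨a, a', ha⟩
    have : ¬ IsBot a := fun h => hbot _ _ h ha
    simp only [IsBot, not_forall, not_le] at this
    obtain ⟨b, hb⟩ := this
    obtain ⟨l, r, h2, h3, h4⟩ := hjump _ _ hb
    exact ⟨⟨l, r, h3⟩, h3.1.trans_le h4⟩
  have : NoMaxOrder L := by
    refine ⟨?_⟩
    rintro ⟨a, a', ha⟩
    have : ¬ IsTop a' := fun h => htop _ _ h ha
    simp only [IsTop, not_forall, not_le] at this
    obtain ⟨b, hb⟩ := this
    obtain ⟨l, r, h2, h3, h4⟩ := hjump _ _ hb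
    exact ⟨⟨l, r, h3⟩, ha.1.trans_le h2⟩
  obtain ⟨e⟩ := Order.iso_of_countable_dense L ℚ
  let F : E → LowerSet L := fun x => ⟨{l | (l : E) < x}, fun a b hba ha => lt_of_le_of_lt hba ha⟩
  have hF : StrictMono F := by
    intro x y h
    refine lt_of_le_of_ne (fun l (hl : (l : E) < x) => hl.trans h) ?_
    intro heq
    obtain ⟨l, r, h2, h3, h4⟩ := hjump _ _ h
    have h5 : (⟨l, r, h3⟩ : L) ∈ F y := h3.1.trans_le h4
    rw [← heq] at h5
    exact absurd h5 (not_lt.2 h2)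
  have hFs : Function.Surjective F := by
    intro S
    by_cases hm : ∃ m : L, IsGreatest (S : Set L) m
    · obtain ⟨⟨m, m', hm⟩, h1, h2⟩ := hm
      refine ⟨m', ?_⟩
      ext l
      constructor
      · intro (h : (l : E) < m')
        exact S.lower (show l ≤ ⟨m, m', hm⟩ from not_lt.1 fun h' => hm.2 h' h) h1
      · intro h
        exact lt_of_le_of_lt (h2 h) hm.1
    · obtain ⟨x, hx⟩ := hsup (Subtype.val '' (S : Set L))
      refine ⟨x, ?_⟩
      ext l
      constructor
      · intro (h : (l : E) < x)
        obtain ⟨_, ⟨k, hk, rfl⟩, h2⟩ := (lt_isLUB_iff hx).1 h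
        exact S.lower (show l ≤ k from h2.le) hk
      · intro h
        refine lt_of_le_of_ne (hx.1 ⟨l, h, rfl⟩) ?_
        intro h'
        exact hm ⟨l, h, fun k hk => show (k : E) ≤ l from h' ▸ hx.1 ⟨k, hk, rfl⟩⟩
  exact ⟨(StrictMono.orderIsoOfSurjective F hF hFs).trans (LowerSet.map e)⟩

section PartialIso
variable {X : Type*} [LinearOrder X]

/-- `p` and `q` are consecutive points of the relation `R`. -/
def IsGap (R : Set (X × X)) (p q : X × X) : Prop :=
  p ∈ R ∧ q ∈ R ∧ p.1 < q.1 ∧ ∀ w ∈ R, w.1 ≤ p.1 ∨ q.1 ≤ w.1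

/-- `R` is the graph of an order isomorphism between a subset of `A` and a subset of `B` whose
complements are covered by the gaps of these subsets. -/
structure IsPartialIso (A B : Set X) (R : Set (X × X)) : Prop where
  sub : ∀ p ∈ R, p.1 ∈ A ∧ p.2 ∈ B
  le_iff : ∀ p ∈ R, ∀ q ∈ R, p.1 ≤ q.1 ↔ p.2 ≤ q.2
  fst : ∀ z ∈ A, (∃ p ∈ R, p.1 = z) ∨ ∃ p q, IsGap R p q ∧ p.1 < z ∧ z < q.1
  snd : ∀ z ∈ B, (∃ p ∈ R, p.2 = z) ∨ ∃ p q, IsGap R p q ∧ p.2 < z ∧ z < q.2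

/-- Every interval between two points `p`, `q` carries a partial isomorphism which is total
on `K`. -/
def CanFill (K : Set X) : Prop :=
  ∀ p q : X × X, p.1 < q.1 → p.2 < q.2 → ∃ T : Set (X × X), p ∈ T ∧ q ∈ T ∧
    IsPartialIso (Icc p.1 q.1) (Icc p.2 q.2) T ∧
    (∀ z ∈ K, z ∈ Icc p.1 q.1 → ∃ t ∈ T, t.1 = z) ∧ (∀ z ∈ K, z ∈ Icc p.2 q.2 → ∃ t ∈ T, t.2 = z)

theorem IsPartialIso.exists_extension {A B : Set X} [hA : A.OrdConnected] [hB : B.OrdConnected]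
    {R : Set (X × X)} (hR : IsPartialIso A B R) {K : Set X} (hK : CanFill K) :
    ∃ R', IsPartialIso A B R' ∧ R ⊆ R' ∧ (∀ z ∈ K, z ∈ A → ∃ t ∈ R', t.1 = z) ∧
      (∀ z ∈ K, z ∈ B → ∃ t ∈ R', t.2 = z) := by
  have hlt : ∀ p ∈ R, ∀ q ∈ R, p.1 < q.1 ↔ p.2 < q.2 := fun p hp q hq => by
    simpa using not_congr (hR.le_iff q hq p hp)
  have hfill : ∀ p q : X × X, ∃ T : Set (X × X), IsGap R p q → p ∈ T ∧ q ∈ T ∧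
    IsPartialIso (Icc p.1 q.1) (Icc p.2 q.2) T ∧
    (∀ z ∈ K, z ∈ Icc p.1 q.1 → ∃ t ∈ T, t.1 = z) ∧
    (∀ z ∈ K, z ∈ Icc p.2 q.2 → ∃ t ∈ T, t.2 = z) := by
    intro p q
    by_cases h : IsGap R p q
    · obtain ⟨T, hT⟩ := hK p q h.2.2.1 ((hlt p h.1 q h.2.1).1 h.2.2.1)
      exact ⟨T, fun _ => hT⟩
    · exact ⟨∅, fun h' => absurd h' h⟩
  choose T hpT hqT hT hT1 hT2 using hfill
  have gap_or : ∀ p q, IsGap R p q → ∀ w ∈ R, (w.1 ≤ p.1 ∧ w.2 ≤ p.2) ∨ (q.1 ≤ w.1 ∧ q.2 ≤ w.2) := by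
    intro p q h w hw
    have h1 := hR.le_iff w hw p h.1
    have h2 := hR.le_iff q h.2.1 w hw
    rcases h.2.2.2 w hw with h' | h'
    · exact .inl ⟨h', h1.1 h'⟩
    · exact .inr ⟨h', h2.1 h'⟩
  have bds : ∀ p q, IsGap R p q → ∀ w ∈ T p q, (p.1 ≤ w.1 ∧ w.1 ≤ q.1) ∧ p.2 ≤ w.2 ∧ w.2 ≤ q.2 :=
    fun p q h w hw => (hT p q h).sub w hw
  have gap_gap : ∀ p q, IsGap R p q → ∀ p' q', IsGap R p' q' →
      (p = p' ∧ q = q') ∨ (q.1 ≤ p'.1 ∧ q.2 ≤ p'.2) ∨ (q'.1 ≤ p.1 ∧ q'.2 ≤ p.2) := by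
    intro p q h p' q' h'
    have hh := h.2.2.1
    have hh' := h'.2.2.1
    rcases gap_or p q h p' h'.1 with h1 | h1
    · rcases gap_or p' q' h' p h.1 with h2 | h2
      · rcases gap_or p q h q' h'.2.1 with h3 | h3
        · exact .inr (.inr h3)
        · rcases gap_or p' q' h' q h.2.1 with h4 | h4
          · exact .inr (.inl h4)
          · exact .inl ⟨Prod.ext (le_antisymm h2.1 h1.1) (le_antisymm h2.2 h1.2),
              Prod.ext (le_antisymm h3.1 h4.1) (le_antisymm h3.2 h4.2)⟩
      · exact .inr (.inr h2)
    · exact .inr (.inl h1)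
  have key : ∀ a b c : X × X, (a.1 ≤ b.1 ∧ a.2 ≤ b.2) → (b.1 ≤ c.1 ∧ b.2 ≤ c.2) →
      (b.1 ≤ a.1 ↔ b.2 ≤ a.2) → (c.1 ≤ b.1 ↔ c.2 ≤ b.2) →
      (a.1 ≤ c.1 ↔ a.2 ≤ c.2) ∧ (c.1 ≤ a.1 ↔ c.2 ≤ a.2) := by
    intro a b c h1 h2 h3 h4
    refine ⟨iff_of_true (h1.1.trans h2.1) (h1.2.trans h2.2), fun h => ?_, fun h => ?_⟩
    · exact (h4.1 (h.trans h1.1)).trans (h3.1 (h2.1.trans h))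
    · exact (h4.2 (h.trans h1.2)).trans (h3.2 (h2.2.trans h))
  have RT : ∀ a ∈ R, ∀ p q, IsGap R p q → ∀ c ∈ T p q,
      (a.1 ≤ c.1 ↔ a.2 ≤ c.2) ∧ (c.1 ≤ a.1 ↔ c.2 ≤ a.2) := by
    intro a ha p q h c hc
    have hb := bds p q h c hc
    rcases gap_or p q h a ha with h1 | h1
    · exact key a p c h1 ⟨hb.1.1, hb.2.1⟩ (hR.le_iff _ h.1 _ ha)
        ((hT p q h).le_iff _ hc _ (hpT p q h))
    · exact (key c q a ⟨hb.1.2, hb.2.2⟩ h1 ((hT p q h).le_iff _ (hqT p q h) _ hc)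
        (hR.le_iff _ ha _ h.2.1)).symm
  let R' : Set (X × X) := {w | w ∈ R ∨ ∃ p q, IsGap R p q ∧ w ∈ T p q}
  have gapR' : ∀ p q, IsGap R p q → ∀ p' q', IsGap (T p q) p' q' → IsGap R' p' q' := by
    intro p q h p' q' h'
    have hp := bds p q h _ h'.1
    have hq := bds p q h _ h'.2.1
    refine ⟨.inr ⟨p, q, h, h'.1⟩, .inr ⟨p, q, h, h'.2.1⟩, h'.2.2.1, ?_⟩
    rintro w (hw | ⟨p₁, q₁, h₁, hw⟩)
    · rcases gap_or p q h w hw with h2 | h2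
      · exact .inl (h2.1.trans hp.1.1)
      · exact .inr (hq.1.2.trans h2.1)
    · rcases gap_gap p q h _ _ h₁ with ⟨rfl, rfl⟩ | h2 | h2
      · exact h'.2.2.2 w hw
      · exact .inr ((hq.1.2.trans h2.1).trans (bds _ _ h₁ w hw).1.1)
      · exact .inl (((bds _ _ h₁ w hw).1.2.trans h2.1).trans hp.1.1)
  refine ⟨R', ⟨?_, ?_, ?_, ?_⟩, fun w hw => .inl hw, ?_, ?_⟩
  · rintro w (hw | ⟨p, q, h, hw⟩)
    · exact hR.sub w hw
    · have hb := bds p q h w hw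
      exact ⟨hA.out (hR.sub p h.1).1 (hR.sub q h.2.1).1 hb.1,
        hB.out (hR.sub p h.1).2 (hR.sub q h.2.1).2 hb.2⟩
  · rintro a (ha | ⟨p, q, h, ha⟩) c (hc | ⟨p', q', h', hc⟩)
    · exact hR.le_iff a ha c hc
    · exact (RT a ha p' q' h' c hc).1
    · exact (RT c hc p q h a ha).2
    · have hba := bds p q h a ha
      have hbc := bds p' q' h' c hc
      rcases gap_gap p q h _ _ h' with ⟨rfl, rfl⟩ | h2 | h2
      · exact (hT p q h).le_iff a ha c hc
      · exact (key a q c ⟨hba.1.2, hba.2.2⟩ ⟨h2.1.trans hbc.1.1, h2.2.trans hbc.2.1⟩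
          ((hT p q h).le_iff _ (hqT p q h) _ ha) (RT q h.2.1 p' q' h' c hc).2).1
      · exact (key c q' a ⟨hbc.1.2, hbc.2.2⟩ ⟨h2.1.trans hba.1.1, h2.2.trans hba.2.1⟩
          ((hT p' q' h').le_iff _ (hqT p' q' h') _ hc) (RT q' h'.2.1 p q h a ha).2).2
  · intro z hz
    rcases hR.fst z hz with ⟨p, hp, rfl⟩ | ⟨p, q, h, h1, h2⟩
    · exact .inl ⟨p, .inl hp, rfl⟩
    · rcases (hT p q h).fst z ⟨h1.le, h2.le⟩ with ⟨t, ht, rfl⟩ | ⟨p', q', h', h3⟩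
      · exact .inl ⟨t, .inr ⟨p, q, h, ht⟩, rfl⟩
      · exact .inr ⟨p', q', gapR' p q h p' q' h', h3⟩
  · intro z hz
    rcases hR.snd z hz with ⟨p, hp, rfl⟩ | ⟨p, q, h, h1, h2⟩
    · exact .inl ⟨p, .inl hp, rfl⟩
    · rcases (hT p q h).snd z ⟨h1.le, h2.le⟩ with ⟨t, ht, rfl⟩ | ⟨p', q', h', h3⟩
      · exact .inl ⟨t, .inr ⟨p, q, h, ht⟩, rfl⟩
      · exact .inr ⟨p', q', gapR' p q h p' q' h', h3⟩
  · intro z hzK hz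
    rcases hR.fst z hz with ⟨p, hp, rfl⟩ | ⟨p, q, h, h1, h2⟩
    · exact ⟨p, .inl hp, rfl⟩
    · obtain ⟨t, ht, h3⟩ := hT1 p q h z hzK ⟨h1.le, h2.le⟩
      exact ⟨t, .inr ⟨p, q, h, ht⟩, h3⟩
  · intro z hzK hz
    rcases hR.snd z hz with ⟨p, hp, rfl⟩ | ⟨p, q, h, h1, h2⟩
    · exact ⟨p, .inl hp, rfl⟩
    · obtain ⟨t, ht, h3⟩ := hT2 p q h z hzK ⟨h1.le, h2.le⟩
      exact ⟨t, .inr ⟨p, q, h, ht⟩, h3⟩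

theorem IsPartialIso.nonempty_orderIso {A B : Set X} [A.OrdConnected] [B.OrdConnected]
    {R : Set (X × X)} (hR : IsPartialIso A B R) {K : ℕ → Set X} (hK : ∀ n, CanFill (K n))
    (hcov : ∀ z, ∃ n, z ∈ K n) : Nonempty (A ≃o B) := by
  choose next hnext hsub h1 h2 using
    fun (n : ℕ) (S : {S : Set (X × X) // IsPartialIso A B S}) => S.2.exists_extension (hK n)
  let S : ℕ → {S : Set (X × X) // IsPartialIso A B S} :=
    fun n => Nat.rec ⟨R, hR⟩ (fun k S => ⟨next k S, hnext k S⟩) n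
  have hmono : Monotone fun n => (S n).1 := monotone_nat_of_le_succ fun n => hsub n (S n)
  have hle : ∀ m n, ∀ p ∈ (S m).1, ∀ q ∈ (S n).1, p.1 ≤ q.1 ↔ p.2 ≤ q.2 := fun m n p hp q hq =>
    (S (max m n)).2.le_iff p (hmono (le_max_left m n) hp) q (hmono (le_max_right m n) hq)
  have hA : ∀ a : A, ∃ b : B, ∃ n, ((a : X), (b : X)) ∈ (S n).1 := by
    rintro ⟨a, ha⟩
    obtain ⟨n, hn⟩ := hcov a
    obtain ⟨⟨_, t⟩, ht, rfl⟩ := h1 n (S n) a hn ha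
    exact ⟨⟨t, ((S (n + 1)).2.sub _ ht).2⟩, n + 1, ht⟩
  choose F m hF using hA
  refine ⟨StrictMono.orderIsoOfSurjective F ?_ ?_⟩
  · intro a b hab
    by_contra! h
    exact absurd ((hle _ _ _ (hF b) _ (hF a)).2 h) (not_le.2 hab)
  · rintro ⟨b, hb⟩
    obtain ⟨n, hn⟩ := hcov b
    obtain ⟨⟨t, _⟩, ht, rfl⟩ := h2 n (S n) b hn hb
    refine ⟨⟨t, ((S (n + 1)).2.sub _ ht).1⟩, ?_⟩
    have h := hF ⟨t, ((S (n + 1)).2.sub _ ht).1⟩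
    exact Subtype.ext (le_antisymm ((hle _ (n + 1) _ h _ ht).1 le_rfl)
      ((hle (n + 1) _ _ ht _ h).1 le_rfl))

end PartialIso
theorem exists_strictMono_nat_cofinal {α : Type*} [LinearOrder α] [TopologicalSpace α]
    [OrderClosedTopology α] [SeparableSpace α] [NoMaxOrder α] (a : α) :
    ∃ u : ℕ → α, u 0 = a ∧ StrictMono u ∧ ∀ z, ∃ n, z < u n := by
  have : Nonempty α := ⟨a⟩
  choose g hg using fun x : α => exists_gt x
  let u : ℕ → α := fun n => Nat.rec a (fun k x => g (max x (denseSeq α k))) n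
  have hu : ∀ k, max (u k) (denseSeq α k) < u (k + 1) := fun k => hg _
  refine ⟨u, rfl, strictMono_nat_of_lt_succ fun k => (le_max_left _ _).trans_lt (hu k), ?_⟩
  intro z
  obtain ⟨k, h⟩ := (denseRange_denseSeq α).exists_mem_open isOpen_Ioi
    (show (Ioi z).Nonempty from exists_gt z)
  exact ⟨k + 1, lt_trans h ((le_max_right _ _).trans_lt (hu k))⟩

theorem exists_strictMono_int_cofinal (α : Type*) [LinearOrder α] [TopologicalSpace α]
    [OrderClosedTopology α] [SeparableSpace α] [NoMaxOrder α] [NoMinOrder α] [Nonempty α] :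
    ∃ s : ℤ → α, StrictMono s ∧ ∀ z, ∃ n, s n ≤ z ∧ z < s (n + 1) := by
  obtain ⟨a⟩ := ‹Nonempty α›
  obtain ⟨u, hu0, hu, huc⟩ := exists_strictMono_nat_cofinal a
  have : SeparableSpace αᵒᵈ := ‹SeparableSpace α›
  obtain ⟨w, hw0, hw, hwc⟩ := exists_strictMono_nat_cofinal (OrderDual.toDual a)
  let s : ℤ → α := fun n => Int.rec u (fun k => OrderDual.ofDual (w (k + 1))) n
  have hs : StrictMono s := by
    refine strictMono_int_of_lt_succ ?_
    rintro (n | n | n)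
    · exact hu (Nat.lt_succ_self n)
    · have : s (Int.negSucc 0 + 1) = a := hu0
      rw [this]
      have := hw (Nat.lt_succ_self 0)
      rw [hw0] at this
      exact this
    · exact hw (Nat.lt_succ_self (n + 1))
  refine ⟨s, hs, fun z => ?_⟩
  obtain ⟨m, hm⟩ := huc z
  obtain ⟨k, hk⟩ := hwc (OrderDual.toDual z)
  have hk' : s (Int.negSucc k) < z := by
    have : w (k + 1) > w k := hw (Nat.lt_succ_self k)
    exact lt_trans (show s (Int.negSucc k) < OrderDual.ofDual (w k) from this) hk
  obtain ⟨n, hn, hn'⟩ := Int.exists_greatest_of_bdd (P := fun n => s n ≤ z)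
    ⟨m, fun i hi => le_of_lt (hs.lt_iff_lt.1 (lt_of_le_of_lt hi (show z < s m from hm)))⟩
    ⟨Int.negSucc k, hk'.le⟩
  exact ⟨n, hn, not_le.1 fun h => by have := hn' _ h; omega⟩

section PartialIso
variable {X : Type*} [LinearOrder X]

theorem isPartialIso_range_int {A B : Set X} (s : ℤ → A) (s' : ℤ → B) (hs : StrictMono s)
    (hs' : StrictMono s') (hsc : ∀ z, ∃ n, s n ≤ z ∧ z < s (n + 1))
    (hsc' : ∀ z, ∃ n, s' n ≤ z ∧ z < s' (n + 1)) :
    IsPartialIso A B (range fun n => ((s n : X), (s' n : X))) := by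
  have hgap : ∀ n, IsGap (range fun n => ((s n : X), (s' n : X))) (s n, s' n)
      (s (n + 1), s' (n + 1)) := by
    refine fun n => ⟨⟨n, rfl⟩, ⟨n + 1, rfl⟩, hs (lt_add_one n), ?_⟩
    rintro _ ⟨m, rfl⟩
    rcases le_or_gt m n with h | h
    · exact .inl (hs.monotone h)
    · exact .inr (hs.monotone (show n + 1 ≤ m from h))
  refine ⟨?_, ?_, ?_, ?_⟩
  · rintro _ ⟨n, rfl⟩
    exact ⟨(s n).2, (s' n).2⟩
  · rintro _ ⟨n, rfl⟩ _ ⟨m, rfl⟩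
    exact (hs.le_iff_le (a := n) (b := m)).trans hs'.le_iff_le.symm
  · intro z hz
    obtain ⟨n, h1, h2⟩ := hsc ⟨z, hz⟩
    rcases h1.eq_or_lt with h | h
    · exact .inl ⟨_, ⟨n, rfl⟩, congrArg Subtype.val h⟩
    · exact .inr ⟨_, _, hgap n, h, h2⟩
  · intro z hz
    obtain ⟨n, h1, h2⟩ := hsc' ⟨z, hz⟩
    rcases h1.eq_or_lt with h | h
    · exact .inl ⟨_, ⟨n, rfl⟩, congrArg Subtype.val h⟩
    · exact .inr ⟨_, _, hgap n, h, h2⟩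

/-- A set which, as an order, is a Cantor set between `x` and `y`, and whose complement is covered
by its gaps. -/
structure IsCantorSegment (x y : X) (E : Set X) : Prop where
  subset : E ⊆ Icc x y
  left_mem : x ∈ E
  right_mem : y ∈ E
  orderIso : Nonempty (E ≃o LowerSet ℚ)
  gap : ∀ z ∈ Icc x y, z ∉ E → ∃ l ∈ E, ∃ r ∈ E, l < z ∧ z < r ∧ ∀ w ∈ E, w ≤ l ∨ r ≤ w

theorem canFill_of_isCantorSegment {K : Set X}
    (h : ∀ x y : X, x < y → ∃ E, IsCantorSegment x y E ∧ K ∩ Icc x y ⊆ E) : CanFill K := by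
  rintro ⟨x, x'⟩ ⟨y, y'⟩ hxy hxy'
  obtain ⟨E, hE, hKE⟩ := h x y hxy
  obtain ⟨E', hE', hKE'⟩ := h x' y' hxy'
  obtain ⟨e⟩ := hE.orderIso
  obtain ⟨e'⟩ := hE'.orderIso
  let g : E ≃o E' := e.trans e'.symm
  have hx : (g ⟨x, hE.left_mem⟩ : X) = x' := by
    refine le_antisymm ?_ (hE'.subset (g _).2).1
    have : g ⟨x, hE.left_mem⟩ ≤ ⟨x', hE'.left_mem⟩ := by
      rw [← g.le_symm_apply]
      exact (hE.subset (g.symm _).2).1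
    exact this
  have hy : (g ⟨y, hE.right_mem⟩ : X) = y' := by
    refine le_antisymm (hE'.subset (g _).2).2 ?_
    have : ⟨y', hE'.right_mem⟩ ≤ g ⟨y, hE.right_mem⟩ := by
      rw [← g.symm_apply_le]
      exact (hE.subset (g.symm _).2).2
    exact this
  let T : Set (X × X) := range fun t : E => ((t : X), (g t : X))
  have hg : ∀ s t : E, (s : X) ≤ t ↔ (g s : X) ≤ g t := fun s t => (g.le_iff_le (x := s)).symm
  refine ⟨T, ⟨⟨x, hE.left_mem⟩, Prod.ext rfl hx⟩, ⟨⟨y, hE.right_mem⟩, Prod.ext rfl hy⟩,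
    ⟨?_, ?_, ?_, ?_⟩, ?_, ?_⟩
  · rintro _ ⟨t, rfl⟩
    exact ⟨hE.subset t.2, hE'.subset (g t).2⟩
  · rintro _ ⟨s, rfl⟩ _ ⟨t, rfl⟩
    exact hg s t
  · intro z hz
    by_cases hzE : z ∈ E
    · exact .inl ⟨_, ⟨⟨z, hzE⟩, rfl⟩, rfl⟩
    · obtain ⟨l, hl, r, hr, hlz, hzr, hw⟩ := hE.gap z hz hzE
      refine .inr ⟨_, _, ⟨⟨⟨l, hl⟩, rfl⟩, ⟨⟨r, hr⟩, rfl⟩, hlz.trans hzr, ?_⟩, hlz, hzr⟩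
      rintro _ ⟨t, rfl⟩
      exact hw t t.2
  · intro z hz
    by_cases hzE : z ∈ E'
    · exact .inl ⟨_, ⟨g.symm ⟨z, hzE⟩, rfl⟩, by simp⟩
    · obtain ⟨l, hl, r, hr, hlz, hzr, hw⟩ := hE'.gap z hz hzE
      refine .inr ⟨_, _, ⟨⟨g.symm ⟨l, hl⟩, rfl⟩, ⟨g.symm ⟨r, hr⟩, rfl⟩, ?_, ?_⟩, ?_, ?_⟩
      · exact g.symm.strictMono (hlz.trans hzr)
      · rintro _ ⟨t, rfl⟩
        rcases hw _ (g t).2 with h1 | h1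
        · exact .inl (g.le_symm_apply.2 h1)
        · exact .inr (g.symm_apply_le.2 h1)
      · simpa using hlz
      · simpa using hzr
  · exact fun z hzK hz => ⟨_, ⟨⟨z, hKE ⟨hzK, hz⟩⟩, rfl⟩, rfl⟩
  · exact fun z hzK hz => ⟨_, ⟨g.symm ⟨z, hKE' ⟨hzK, hz⟩⟩, rfl⟩, by simp⟩

end PartialIso

section Compact
variable {X : Type*} [LinearOrder X] [TopologicalSpace X] [OrderTopology X]

theorem IsCompact.exists_gap {E : Set X} (hE : IsCompact E) {x y z : X} (hx : x ∈ E) (hy : y ∈ E)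
    (hz : z ∈ Icc x y) (hzE : z ∉ E) :
    ∃ l ∈ E, ∃ r ∈ E, l < z ∧ z < r ∧ ∀ w ∈ E, w ≤ l ∨ r ≤ w := by
  obtain ⟨l, hl, hl'⟩ := (hE.inter_right isClosed_Iic).exists_isGreatest ⟨x, hx, hz.1⟩
  obtain ⟨r, hr, hr'⟩ := (hE.inter_right isClosed_Ici).exists_isLeast ⟨y, hy, hz.2⟩
  refine ⟨l, hl.1, r, hr.1, lt_of_le_of_ne hl.2 ?_, lt_of_le_of_ne hr.2 ?_, fun w hw => ?_⟩
  · rintro rfl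
    exact hzE hl.1
  · rintro rfl
    exact hzE hr.1
  · rcases le_total w z with h | h
    · exact .inl (hl' ⟨hw, h⟩)
    · exact .inr (hr' ⟨hw, h⟩)

/-- A compact set without isolated points and with empty interior is an order-theoretic
Cantor set. -/
theorem IsCompact.isCantorSegment [SecondCountableTopology X] {E : Set X} (hE : IsCompact E)
    {x y : X} (hxy : x < y) (hEs : E ⊆ Icc x y) (hx : x ∈ E) (hy : y ∈ E)
    (hacc : ∀ z ∈ E, ∀ U ∈ 𝓝 z, ∃ w ∈ E, w ∈ U ∧ w ≠ z)
    (hempty : ∀ a b : X, a < b → ∃ z, a < z ∧ z < b ∧ z ∉ E) : IsCantorSegment x y E := by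
  refine ⟨hEs, hx, hy, ?_, fun z hz hzE => hE.exists_gap hx hy hz hzE⟩
  have : Nontrivial E := ⟨⟨x, hx⟩, ⟨y, hy⟩, fun h => hxy.ne (congrArg Subtype.val h)⟩
  apply nonempty_orderIso_lowerSet_rat
  · intro S
    rcases S.eq_empty_or_nonempty with rfl | hS
    · exact ⟨⟨x, hx⟩, fun a ha => absurd ha (notMem_empty a), fun b _ => (hEs b.2).1⟩
    · have h1 : closure (Subtype.val '' S) ⊆ E :=
        hE.isClosed.closure_subset_iff.2 (by rintro _ ⟨a, -, rfl⟩; exact a.2)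
      obtain ⟨m, hm, hm'⟩ := (hE.of_isClosed_subset isClosed_closure h1).exists_isLUB
        (hS.image _).closure
      refine ⟨⟨m, h1 hm⟩, fun a ha => hm'.1 (subset_closure ⟨a, ha, rfl⟩), fun b hb => hm'.2 ?_⟩
      refine closure_minimal (t := Iic (b : X)) ?_ isClosed_Iic
      rintro _ ⟨a, ha, rfl⟩
      exact hb ha
  · rintro ⟨a, ha⟩ ⟨b, hb⟩ (hab : a < b)
    obtain ⟨z, h1, h2, hz⟩ := hempty a b hab
    obtain ⟨l, hl, r, hr, hlz, hzr, hw⟩ := hE.exists_gap ha hb ⟨h1.le, h2.le⟩ hz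
    refine ⟨⟨l, hl⟩, ⟨r, hr⟩, ?_, ⟨hlz.trans hzr, ?_⟩, ?_⟩
    · exact (hw a ha).resolve_right (not_le.2 (h1.trans hzr))
    · rintro ⟨c, hc⟩ (h3 : l < c) (h4 : c < r)
      rcases hw c hc with h | h
      · exact absurd h3 (not_lt.2 h)
      · exact absurd h4 (not_lt.2 h)
    · exact (hw b hb).resolve_left (not_le.2 (hlz.trans h2))
  · rintro ⟨a, ha⟩ ⟨b, hb⟩ ⟨c, hc⟩ hab hbc
    obtain ⟨w, hw, hwU, hne⟩ := hacc b hb _ (Ioo_mem_nhds (show a < b from hab.1)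
      (show b < c from hbc.1))
    rcases lt_or_gt_of_ne hne with h | h
    · exact hab.2 (c := ⟨w, hw⟩) hwU.1 h
    · exact hbc.2 (c := ⟨w, hw⟩) h hwU.2
  · rintro ⟨a, ha⟩ ⟨b, hb⟩ hbot hab
    obtain ⟨w, hw, hwU, hne⟩ := hacc a ha _ (Iio_mem_nhds (show a < b from hab.1))
    exact hab.2 (c := ⟨w, hw⟩) (lt_of_le_of_ne (hbot ⟨w, hw⟩) fun h =>
      hne (congrArg Subtype.val h).symm) hwU
  · rintro ⟨a, ha⟩ ⟨b, hb⟩ htop hab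
    obtain ⟨w, hw, hwU, hne⟩ := hacc b hb _ (Ioi_mem_nhds (show a < b from hab.1))
    exact hab.2 (c := ⟨w, hw⟩) hwU (lt_of_le_of_ne (htop ⟨w, hw⟩) fun h =>
      hne (congrArg Subtype.val h))
  · refine (countable_image_lt_image_Ioi (Subtype.val : E → X)).mono ?_
    rintro l ⟨r, hr⟩
    exact ⟨r, hr.1, fun w hw => not_lt.1 fun h => hr.2 hw h⟩

end Compact

section Group
variable {X : Type*} [AddCommGroup X] [LinearOrder X] [IsOrderedAddMonoid X] [TopologicalSpace X]
  [OrderTopology X] [SecondCountableTopology X]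

theorem exists_isCompact_neg_mem_of_uncountable [SigmaCompactSpace X] (hX : Uncountable X) :
    ∃ Q : Set X, IsCompact Q ∧ 0 ∈ Q ∧ (∀ q ∈ Q, -q ∈ Q) ∧
      ∀ q ∈ Q, ∀ U ∈ 𝓝 q, ∃ w ∈ Q, w ∈ U ∧ w ≠ q := by
  obtain ⟨n, hn⟩ : ∃ n, ¬ (compactCovering X n).Countable := by
    by_contra! h
    have := countable_iUnion h
    rw [iUnion_compactCovering] at this
    exact not_countable (countable_univ_iff.1 this)
  have hc := isCompact_compactCovering X n
  obtain ⟨P, hP, ⟨p, hp⟩, hPs⟩ := exists_perfect_nonempty_of_isClosed_of_not_countable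
    hc.isClosed hn
  have hPc : IsCompact P := hc.of_isClosed_subset hP.closed hPs
  refine ⟨(fun a => a - p) '' P ∪ (fun a => p - a) '' P, ?_, .inl ⟨p, hp, sub_self p⟩, ?_, ?_⟩
  · exact (hPc.image (by fun_prop)).union (hPc.image (by fun_prop))
  · rintro _ (⟨a, ha, rfl⟩ | ⟨a, ha, rfl⟩)
    · exact .inr ⟨a, ha, (neg_sub a p).symm⟩
    · exact .inl ⟨a, ha, (neg_sub p a).symm⟩
  · rintro _ (⟨a, ha, rfl⟩ | ⟨a, ha, rfl⟩) U hU
    · have h : (fun a => a - p) ⁻¹' U ∈ 𝓝 a :=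
        (show Continuous fun a : X => a - p by fun_prop).continuousAt hU
      obtain ⟨b, ⟨hbU, hbP⟩, hne⟩ := accPt_iff_nhds.1 (hP.acc a ha) _ h
      exact ⟨b - p, .inl ⟨b, hbP, rfl⟩, hbU, by simpa using hne⟩
    · have h : (fun a => p - a) ⁻¹' U ∈ 𝓝 a :=
        (show Continuous fun a : X => p - a by fun_prop).continuousAt hU
      obtain ⟨b, ⟨hbU, hbP⟩, hne⟩ := accPt_iff_nhds.1 (hP.acc a ha) _ h
      exact ⟨p - b, .inr ⟨b, hbP, rfl⟩, hbU, by simpa using hne⟩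

theorem exists_isCantorSegment [SigmaCompactSpace X] (hX : Uncountable X)
    (hempty : ∀ E : Set X, IsCompact E → ∀ a b, a < b → ∃ z, a < z ∧ z < b ∧ z ∉ E)
    {K : Set X} (hK : IsCompact K) (x y : X) (hxy : x < y) :
    ∃ E, IsCantorSegment x y E ∧ K ∩ Icc x y ⊆ E := by
  obtain ⟨Q, hQ, hQ0, hQneg, hQacc⟩ := exists_isCompact_neg_mem_of_uncountable hX
  let K₀ : Set X := insert x (insert y K)
  have hK₀ : IsCompact K₀ := (hK.insert y).insert x
  let E : Set X := (fun p : X × X => p.1 + p.2) '' (K₀ ×ˢ Q) ∩ Icc x y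
  have hE : IsCompact E := ((hK₀.prod hQ).image continuous_add).inter_right isClosed_Icc
  have hKE : K₀ ∩ Icc x y ⊆ E := fun z hz => ⟨⟨(z, 0), ⟨hz.1, hQ0⟩, add_zero z⟩, hz.2⟩
  -- a neighbourhood of an endpoint contains points of `Q` on either side
  have hside : ∀ u : X, ∀ U ∈ 𝓝 u, ∃ q ∈ Q, 0 < q ∧ u + q ∈ U ∧ u - q ∈ U := by
    intro u U hU
    have h1 : (fun q => u + q) ⁻¹' U ∈ 𝓝 (0 : X) :=
      (show Continuous fun q : X => u + q by fun_prop).continuousAt (by simpa using hU)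
    have h2 : (fun q => u - q) ⁻¹' U ∈ 𝓝 (0 : X) :=
      (show Continuous fun q : X => u - q by fun_prop).continuousAt (by simpa using hU)
    obtain ⟨q, hq, ⟨hq1, hq2⟩, hne⟩ := hQacc 0 hQ0 _ (inter_mem h1 h2)
    rcases lt_or_gt_of_ne hne with h | h
    · refine ⟨-q, hQneg q hq, neg_pos.2 h, ?_, ?_⟩
      · simpa [sub_eq_add_neg] using hq2
      · simpa using hq1
    · exact ⟨q, hq, h, hq1, hq2⟩
  refine ⟨E, hE.isCantorSegment hxy inter_subset_right ?_ ?_ ?_ (hempty E hE), ?_⟩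
  · exact hKE ⟨mem_insert _ _, left_mem_Icc.2 hxy.le⟩
  · exact hKE ⟨mem_insert_of_mem _ (mem_insert _ _), right_mem_Icc.2 hxy.le⟩
  · rintro z ⟨⟨⟨k, q⟩, ⟨hk, hq⟩, rfl⟩, hz⟩ U hU
    rcases hz.1.eq_or_lt with hzx | hzx
    · dsimp only at hzx hU ⊢
      rw [← hzx] at hU ⊢
      obtain ⟨r, hr, hr0, hrU, -⟩ := hside x _ (inter_mem hU (Iio_mem_nhds hxy))
      exact ⟨x + r, ⟨⟨(x, r), ⟨mem_insert _ _, hr⟩, rfl⟩, by simpa using hr0.le, hrU.2.le⟩, hrU.1,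
        by simpa using hr0.ne'⟩
    rcases hz.2.eq_or_lt with hzy | hzy
    · dsimp only at hzy hU ⊢
      rw [hzy] at hU ⊢
      obtain ⟨r, hr, hr0, -, hrU⟩ := hside y _ (inter_mem hU (Ioi_mem_nhds hxy))
      exact ⟨y - r, ⟨⟨(y, -r), ⟨mem_insert_of_mem _ (mem_insert _ _), hQneg r hr⟩,
        (sub_eq_add_neg y r).symm⟩, hrU.2.le, by simpa using hr0.le⟩, hrU.1,
        by simpa using hr0.ne'⟩
    · have h1 : (fun q => k + q) ⁻¹' (U ∩ Ioo x y) ∈ 𝓝 q :=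
        (show Continuous fun q : X => k + q by fun_prop).continuousAt
          (inter_mem hU (Ioo_mem_nhds hzx hzy))
      obtain ⟨r, hr, hrU, hne⟩ := hQacc q hq _ h1
      exact ⟨k + r, ⟨⟨(k, r), ⟨hk, hr⟩, rfl⟩, Ioo_subset_Icc_self hrU.2⟩, hrU.1, by simpa using hne⟩
  · exact fun z hz => hKE ⟨mem_insert_of_mem _ (mem_insert_of_mem _ hz.1), hz.2⟩

/-- If compact sets have empty interior, all nonempty open convex subsets of a σ-compact ordered
group are isomorphic. -/
theorem nonempty_orderIso_of_isOpen [SigmaCompactSpace X] [Nontrivial X]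
    (hempty : ∀ E : Set X, IsCompact E → ∀ a b, a < b → ∃ z, a < z ∧ z < b ∧ z ∉ E)
    (A B : Set X) [hA : A.OrdConnected] [hB : B.OrdConnected] (hAo : IsOpen A) (hBo : IsOpen B)
    (hAn : A.Nonempty) (hBn : B.Nonempty) : Nonempty (A ≃o B) := by
  have : DenselyOrdered X := ⟨fun a b hab => by
    obtain ⟨z, h1, h2, -⟩ := hempty ∅ isCompact_empty a b hab
    exact ⟨z, h1, h2⟩⟩
  have hmax : ∀ S : Set X, IsOpen S → NoMaxOrder S := by
    refine fun S hS => ⟨fun a => ?_⟩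
    obtain ⟨u, hu, hus⟩ := exists_Ico_subset_of_mem_nhds (hS.mem_nhds a.2) (exists_gt _)
    obtain ⟨v, hv1, hv2⟩ := exists_between hu
    exact ⟨⟨v, hus ⟨hv1.le, hv2⟩⟩, hv1⟩
  have hmin : ∀ S : Set X, IsOpen S → NoMinOrder S := by
    refine fun S hS => ⟨fun a => ?_⟩
    obtain ⟨u, hu, hus⟩ := exists_Ioc_subset_of_mem_nhds (hS.mem_nhds a.2) (exists_lt _)
    obtain ⟨v, hv1, hv2⟩ := exists_between hu
    exact ⟨⟨v, hus ⟨hv1, hv2.le⟩⟩, hv2⟩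
  have := hmax A hAo
  have := hmin A hAo
  have := hmax B hBo
  have := hmin B hBo
  have := hAn.to_subtype
  have := hBn.to_subtype
  by_cases hX : Countable X
  · exact Order.iso_of_countable_dense A B
  · rw [not_countable_iff] at hX
    obtain ⟨s, hs, hsc⟩ := exists_strictMono_int_cofinal A
    obtain ⟨s', hs', hsc'⟩ := exists_strictMono_int_cofinal B
    exact (isPartialIso_range_int s s' hs hs' hsc hsc').nonempty_orderIso
      (fun n => canFill_of_isCantorSegment
        (exists_isCantorSegment hX hempty (isCompact_compactCovering X n)))
      exists_mem_compactCovering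

end Group

theorem exists_homeomorph_of_bijective {J Y X : Type*} [TopologicalSpace J] [DiscreteTopology J]
    [TopologicalSpace Y] [TopologicalSpace X] (F : J → Y → X) (hc : ∀ j, Continuous (F j))
    (ho : ∀ j, IsOpenMap (F j)) (hb : Function.Bijective fun p : J × Y => F p.1 p.2) :
    ∃ Ψ : J × Y ≃ₜ X, ∀ j y, Ψ (j, y) = F j y := by
  have hcont : Continuous fun p : J × Y => F p.1 p.2 := continuous_prod_of_discrete_left.2 hc
  have hopen : IsOpenMap fun p : J × Y => F p.1 p.2 := by
    intro U hU
    have : (fun p : J × Y => F p.1 p.2) '' U = ⋃ j, F j '' ((fun y => (j, y)) ⁻¹' U) := by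
      ext x
      simp
    rw [this]
    exact isOpen_iUnion fun j => ho j _ (hU.preimage (by fun_prop))
  exact ⟨(Equiv.ofBijective _ hb).toHomeomorphOfContinuousOpen hcont hopen, fun _ _ => rfl⟩

section Dynamics
variable {X : Type*} [LinearOrder X]

/-- Two points are equivalent if each lies in the convex hull of the orbit of the other one. -/
def orbitHull (f : X ≃o X) : Setoid X where
  r x y := ∃ m n : ℤ, (f ^ m) x ≤ y ∧ y ≤ (f ^ n) x
  iseqv := by
    refine ⟨fun x => ⟨0, 0, le_rfl, le_rfl⟩, ?_, ?_⟩
    · rintro x y ⟨m, n, h1, h2⟩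
      refine ⟨-n, -m, ?_, ?_⟩
      · have := (f ^ (-n)).monotone h2
        rwa [← RelIso.mul_apply, ← zpow_add, neg_add_cancel] at this
      · have := (f ^ (-m)).monotone h1
        rwa [← RelIso.mul_apply, ← zpow_add, neg_add_cancel] at this
    · rintro x y z ⟨m, n, h1, h2⟩ ⟨m', n', h3, h4⟩
      refine ⟨m' + m, n' + n, ?_, ?_⟩
      · have := (f ^ m').monotone h1
        rw [← RelIso.mul_apply, ← zpow_add] at this
        exact this.trans h3
      · have := (f ^ n').monotone h2
        rw [← RelIso.mul_apply, ← zpow_add] at this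
        exact h4.trans this

theorem orbitHull_zpow (f : X ≃o X) (n : ℤ) (x : X) : orbitHull f x ((f ^ n) x) :=
  ⟨n, n, le_rfl, le_rfl⟩

theorem orbitHull_inv (f : X ≃o X) (x y : X) (h : orbitHull f x y) : orbitHull f⁻¹ x y := by
  obtain ⟨m, n, h1, h2⟩ := h
  exact ⟨-m, -n, by simpa using h1, by simpa using h2⟩

theorem strictMono_zpow_apply {f : X ≃o X} {x : X} (h : x < f x) :
    StrictMono fun n : ℤ => (f ^ n) x := by
  refine strictMono_int_of_lt_succ fun n => ?_
  rw [zpow_add_one, RelIso.mul_apply]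
  exact (f ^ n).strictMono h

variable [TopologicalSpace X] [OrderTopology X]

/-- An open convex fundamental domain for the action of `f` on the orbit hull of `x`. -/
structure IsFundDomain (f : X ≃o X) (x : X) (D : Set X) : Prop where
  isOpen : IsOpen D
  ordConnected : D.OrdConnected
  nonempty : D.Nonempty
  rel : ∀ y ∈ D, orbitHull f x y
  exists_mem : ∀ y, orbitHull f x y → ∃ n : ℤ, (f ^ n) y ∈ D
  unique : ∀ y, ∀ m n : ℤ, (f ^ m) y ∈ D → (f ^ n) y ∈ D → m = n

theorem exists_isFundDomain_of_lt {f : X ≃o X} {x : X} (hx : x < f x)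
    (hcut : ∀ x y : X, x < y → ∃ U : Set X, IsClopen U ∧ IsUpperSet U ∧ x ∉ U ∧ y ∈ U) :
    ∃ D, IsFundDomain f x D := by
  obtain ⟨U, hU, hUu, hxU, hfU⟩ := hcut x (f x) hx
  have hmono := strictMono_zpow_apply hx
  have hlow : ∀ n : ℤ, n ≤ 0 → (f ^ n) x ∉ U := fun n hn h =>
    hxU (hUu (show (f ^ n) x ≤ x from hmono.monotone hn) h)
  have hup : ∀ n : ℤ, 1 ≤ n → (f ^ n) x ∈ U := fun n hn =>
    hUu (show f x ≤ (f ^ n) x by simpa using hmono.monotone hn) hfU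
  have hmem : ∀ (y : X) (n : ℤ), (f ^ n) y ∈ U ∩ f.symm ⁻¹' Uᶜ ↔
      (f ^ n) y ∈ U ∧ (f ^ (n - 1)) y ∉ U := by
    intro y n
    have : f.symm ((f ^ n) y) = (f ^ (n - 1)) y := by
      rw [f.symm_apply_eq, ← RelIso.mul_apply, ← zpow_one_add, add_sub_cancel]
    simp [this]
  refine ⟨U ∩ f.symm ⁻¹' Uᶜ, ?_, ?_, ?_, ?_, ?_, ?_⟩
  · exact hU.isOpen.inter (hU.compl.isOpen.preimage f.symm.continuous)
  · refine ⟨fun a ha b hb z hz => ⟨hUu hz.1 ha.1, fun h => hb.2 (hUu ?_ h)⟩⟩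
    exact f.symm.monotone hz.2
  · exact ⟨f x, hfU, by simpa using hxU⟩
  · rintro y ⟨h1, h2⟩
    refine ⟨0, 2, not_lt.1 fun h => hxU (hUu h.le h1), not_lt.1 fun h => h2 ?_⟩
    refine hUu ?_ hfU
    rw [f.le_symm_apply]
    have h3 : (f ^ (2 : ℤ)) x = f (f x) := by
      rw [zpow_two]
      rfl
    rw [← h3]
    exact h.le
  · rintro y ⟨m, n, h1, h2⟩
    obtain ⟨k, hk, hk'⟩ := Int.exists_least_of_bdd (P := fun k : ℤ => (f ^ k) y ∈ U)
      ⟨-n, fun k hk => by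
        by_contra! h
        have h3 := (f ^ k).monotone h2
        rw [← RelIso.mul_apply, ← zpow_add] at h3
        exact hlow (k + n) (by omega) (hUu h3 hk)⟩
      ⟨1 - m, by
        have h3 := (f ^ (1 - m)).monotone h1
        rw [← RelIso.mul_apply, ← zpow_add] at h3
        exact hUu h3 (hup _ (by omega))⟩
    exact ⟨k, (hmem y k).2 ⟨hk, fun h => by have := hk' _ h; omega⟩⟩
  · have key : ∀ y, ∀ m n : ℤ, (f ^ m) y ∈ U ∩ f.symm ⁻¹' Uᶜ → (f ^ n) y ∈ U ∩ f.symm ⁻¹' Uᶜ →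
        ¬ m < n := by
      intro y m n hm hn hmn
      rw [hmem] at hm hn
      have h1 : (f ^ (m - 1)) y < (f ^ m) y := not_le.1 fun h => hm.2 (hUu h hm.1)
      have h2 : y < f y := by
        have : (f ^ m) y = (f ^ (m - 1)) (f y) := by
          rw [← RelIso.mul_apply, ← zpow_add_one, sub_add_cancel]
        rw [this] at h1
        exact (f ^ (m - 1)).lt_iff_lt.1 h1
      exact hn.2 (hUu ((strictMono_zpow_apply h2).monotone (show m ≤ n - 1 by omega)) hm.1)
    exact fun y m n hm hn => le_antisymm (not_lt.1 (key y n m hn hm)) (not_lt.1 (key y m n hm hn))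

theorem exists_isFundDomain {f : X ≃o X} {x : X} (hx : f x ≠ x)
    (hcut : ∀ x y : X, x < y → ∃ U : Set X, IsClopen U ∧ IsUpperSet U ∧ x ∉ U ∧ y ∈ U) :
    ∃ D, IsFundDomain f x D := by
  rcases lt_or_gt_of_ne hx with h | h
  · have h' : x < f⁻¹ x := f.lt_symm_apply.2 h
    obtain ⟨D, hD⟩ := exists_isFundDomain_of_lt h' hcut
    refine ⟨D, hD.isOpen, hD.ordConnected, hD.nonempty, fun y hy => ?_, fun y hy => ?_, ?_⟩
    · exact inv_inv f ▸ orbitHull_inv _ _ _ (hD.rel y hy)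
    · obtain ⟨n, hn⟩ := hD.exists_mem y (orbitHull_inv _ _ _ hy)
      exact ⟨-n, by simpa using hn⟩
    · intro y m n hm hn
      have := hD.unique y (-m) (-n) (by simpa using hm) (by simpa using hn)
      omega
  · exact exists_isFundDomain_of_lt h hcut

theorem discreteTopology_quotient_orbitHull {f : X ≃o X} (hf : ∀ x, f x ≠ x) :
    DiscreteTopology (Quotient (orbitHull f)) := by
  refine discreteTopology_iff_isOpen_singleton.2 ?_
  rintro ⟨x⟩
  refine isQuotientMap_quot_mk.isOpen_preimage.1 (isOpen_iff_mem_nhds.2 ?_)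
  intro y hy
  have hy : orbitHull f x y := (orbitHull f).symm (Quotient.exact hy)
  have hsub : ∀ m n : ℤ, Icc ((f ^ m) y) ((f ^ n) y) ⊆
      (Quot.mk (orbitHull f)) ⁻¹' {Quot.mk _ x} := fun m n z hz =>
    Quotient.sound ((orbitHull f).symm ((orbitHull f).trans hy ⟨m, n, hz.1, hz.2⟩))
  rcases lt_or_gt_of_ne (hf y) with h | h
  · refine mem_of_superset (Icc_mem_nhds (a := f y) (b := f⁻¹ y) h (f.lt_symm_apply.2 h)) ?_
    have := hsub 1 (-1)
    rwa [zpow_one, zpow_neg_one] at this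
  · refine mem_of_superset (Icc_mem_nhds (a := f⁻¹ y) (b := f y) (f.symm_apply_lt.2 h) h) ?_
    have := hsub (-1) 1
    rwa [zpow_one, zpow_neg_one] at this

theorem exists_homeomorph_int_prod_quotient {f : X ≃o X} (hf : ∀ x, f x ≠ x)
    (hcut : ∀ x y : X, x < y → ∃ U : Set X, IsClopen U ∧ IsUpperSet U ∧ x ∉ U ∧ y ∈ U)
    (hiso : ∀ A : Set X, A.OrdConnected → IsOpen A → A.Nonempty → Nonempty (X ≃o A)) :
    ∃ Ψ : (ℤ × Quotient (orbitHull f)) × X ≃ₜ X,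
      ∀ n i y, Ψ ((n + 1, i), y) = f (Ψ ((n, i), y)) := by
  have := discreteTopology_quotient_orbitHull hf
  choose D hD using fun i : Quotient (orbitHull f) => exists_isFundDomain (hf i.out) hcut
  have e := fun i => Classical.choice <|
    hiso (D i) (hD i).ordConnected (hD i).isOpen (hD i).nonempty
  let F : ℤ × Quotient (orbitHull f) → X → X := fun j y => (f ^ j.1) (e j.2 y)
  have hclass : ∀ j y, Quotient.mk (orbitHull f) (F j y) = j.2 := by
    intro j y
    rw [← Quotient.out_eq j.2]
    exact Quotient.sound ((orbitHull f).symm ((orbitHull f).trans ((hD j.2).rel _ (e j.2 y).2)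
      (orbitHull_zpow f j.1 _)))
  have hcont : ∀ j, Continuous (F j) := by
    intro j
    have := (hD j.2).ordConnected
    exact (f ^ j.1).continuous.comp (continuous_subtype_val.comp (e j.2).continuous)
  have hopen : ∀ j, IsOpenMap (F j) := by
    intro j
    have := (hD j.2).ordConnected
    exact (f ^ j.1).toHomeomorph.isOpenMap.comp
      ((hD j.2).isOpen.isOpenMap_subtype_val.comp (e j.2).toHomeomorph.isOpenMap)
  have hinj : Function.Injective fun p : (ℤ × Quotient (orbitHull f)) × X => F p.1 p.2 := by
    rintro ⟨⟨n, i⟩, y⟩ ⟨⟨m, j⟩, z⟩ (h : F (n, i) y = F (m, j) z)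
    have hij : i = j := (hclass (n, i) y).symm.trans ((congrArg _ h).trans (hclass (m, j) z))
    subst hij
    have h1 : (f ^ (-n)) (F (n, i) y) = e i y := by
      rw [← RelIso.mul_apply, ← zpow_add, neg_add_cancel]
      rfl
    have h2 : (f ^ (-m)) (F (n, i) y) = e i z := by
      rw [h, ← RelIso.mul_apply, ← zpow_add, neg_add_cancel]
      rfl
    have hnm := (hD i).unique (F (n, i) y) (-n) (-m) (h1 ▸ (e i y).2) (h2 ▸ (e i z).2)
    have hyz : e i y = e i z := Subtype.ext (by rw [← h1, ← h2, hnm])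
    rw [neg_inj.1 hnm, (e i).injective hyz]
  have hsurj : Function.Surjective fun p : (ℤ × Quotient (orbitHull f)) × X => F p.1 p.2 := by
    intro x
    obtain ⟨n, hn⟩ := (hD (Quotient.mk _ x)).exists_mem x (Quotient.mk_out x)
    refine ⟨((-n, Quotient.mk _ x), (e _).symm ⟨_, hn⟩), ?_⟩
    change (f ^ (-n)) (e _ ((e _).symm ⟨_, hn⟩)) = x
    rw [OrderIso.apply_symm_apply, ← RelIso.mul_apply, ← zpow_add, neg_add_cancel]
    rfl
  obtain ⟨Ψ, hΨ⟩ := exists_homeomorph_of_bijective F hcont hopen ⟨hinj, hsurj⟩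
  refine ⟨Ψ, fun n i y => ?_⟩
  rw [hΨ, hΨ]
  change (f ^ (n + 1)) _ = f ((f ^ n) _)
  rw [add_comm, zpow_one_add, RelIso.mul_apply]

theorem nonempty_homeomorph_of_discrete (J J' : Type*) [TopologicalSpace J] [DiscreteTopology J]
    [TopologicalSpace J'] [DiscreteTopology J'] [Countable J] [Countable J'] [Infinite J]
    [Infinite J'] : Nonempty (J ≃ₜ J') := by
  obtain ⟨e⟩ := nonempty_equiv_of_countable (α := J) (β := J')
  exact ⟨e.toHomeomorph fun s => by simp⟩

/-- Fixed-point free order automorphisms of an ordered space which is isomorphic to each of its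
nonempty open convex subsets are topologically conjugate. -/
theorem exists_homeomorph_semiconj [SeparableSpace X] [Nonempty X] {f g : X ≃o X}
    (hf : ∀ x, f x ≠ x) (hg : ∀ x, g x ≠ x)
    (hcut : ∀ x y : X, x < y → ∃ U : Set X, IsClopen U ∧ IsUpperSet U ∧ x ∉ U ∧ y ∈ U)
    (hiso : ∀ A : Set X, A.OrdConnected → IsOpen A → A.Nonempty → Nonempty (X ≃o A)) :
    ∃ φ : X ≃ₜ X, ∀ x, φ (g x) = f (φ x) := by
  have hcount : ∀ {h : X ≃o X}, (∀ x, h x ≠ x) → Countable (Quotient (orbitHull h)) := fun {h} hh =>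
    have := discreteTopology_quotient_orbitHull hh
    separableSpace_iff_countable.1 inferInstance
  obtain ⟨x₀⟩ := ‹Nonempty X›
  obtain ⟨E⟩ : Nonempty (X ≃ₜ ℤ × X) := by
    obtain ⟨Ψ, -⟩ := exists_homeomorph_int_prod_quotient hf hcut hiso
    have := hcount hf
    have := discreteTopology_quotient_orbitHull hf
    have : Nonempty (Quotient (orbitHull f)) := ⟨Quotient.mk _ x₀⟩
    obtain ⟨e⟩ := nonempty_homeomorph_of_discrete (ℤ × Quotient (orbitHull f)) ℤ
    exact ⟨Ψ.symm.trans (e.prodCongr (.refl X))⟩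
  have key : ∀ {h : X ≃o X}, (∀ x, h x ≠ x) →
      ∃ M : ℤ × X ≃ₜ X, ∀ n y, M (n + 1, y) = h (M (n, y)) := by
    intro h hh
    obtain ⟨Ψ, hΨ⟩ := exists_homeomorph_int_prod_quotient hh hcut hiso
    have := hcount hh
    have := discreteTopology_quotient_orbitHull hh
    have : Nonempty (Quotient (orbitHull h)) := ⟨Quotient.mk _ x₀⟩
    obtain ⟨e⟩ := nonempty_homeomorph_of_discrete ℤ (Quotient (orbitHull h) × ℤ)
    let N : X ≃ₜ Quotient (orbitHull h) × X :=
      E.trans ((e.prodCongr (.refl X)).trans ((Homeomorph.prodAssoc _ _ _).trans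
        ((Homeomorph.refl _).prodCongr E.symm)))
    refine ⟨((Homeomorph.refl ℤ).prodCongr N).trans ((Homeomorph.prodAssoc _ _ _).symm.trans Ψ),
      fun n y => ?_⟩
    exact hΨ n (N y).1 (N y).2
  obtain ⟨M, hM⟩ := key hf
  obtain ⟨M', hM'⟩ := key hg
  refine ⟨M'.symm.trans M, fun x => ?_⟩
  obtain ⟨⟨n, y⟩, rfl⟩ := M'.surjective x
  rw [← hM']
  simp [hM]

theorem exists_notMem_of_isCompact [DenselyOrdered X]
    (hcut : ∀ x y : X, x < y → ∃ U : Set X, IsClopen U ∧ IsUpperSet U ∧ x ∉ U ∧ y ∈ U)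
    (E : Set X) (hE : IsCompact E) (a b : X) (hab : a < b) : ∃ z, a < z ∧ z < b ∧ z ∉ E := by
  by_contra! h
  obtain ⟨a', ha, hb⟩ := exists_between hab
  obtain ⟨b', hab', hb'⟩ := exists_between hb
  have hsub : Icc a' b' ⊆ E := fun z hz => h z (ha.trans_le hz.1) (hz.2.trans_lt hb')
  have hI : IsCompact (Icc a' b') := hE.of_isClosed_subset isClosed_Icc hsub
  obtain ⟨U, hU, hUu, haU, hbU⟩ := hcut a' b' hab'
  obtain ⟨m, ⟨hm1, hm2⟩, hm⟩ := (hI.inter_right hU.compl.isClosed).exists_isGreatest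
    ⟨a', ⟨le_rfl, hab'.le⟩, haU⟩
  obtain ⟨r, ⟨hr1, hr2⟩, hr⟩ := (hI.inter_right hU.isClosed).exists_isLeast
    ⟨b', ⟨hab'.le, le_rfl⟩, hbU⟩
  obtain ⟨z, hmz, hzr⟩ := exists_between (not_le.1 fun h => hm2 (hUu h hr2) : m < r)
  have hz : z ∈ Icc a' b' := ⟨hm1.1.trans hmz.le, hzr.le.trans hr1.2⟩
  by_cases hzU : z ∈ U
  · exact absurd (hr ⟨hz, hzU⟩) (not_le.2 hzr)
  · exact absurd (hm ⟨hz, hzU⟩) (not_le.2 hmz)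

end Dynamics

/-- A homeomorphism of a topological group conjugating `f` to a translation transports the group
structure to one for which `f` is a shift. -/
theorem exists_op_of_homeomorph {G : Type*} [TopologicalSpace G] [AddGroup G]
    [IsTopologicalAddGroup G] {f : G → G} (φ : G ≃ₜ G) {c : G} (hc : c ≠ 0)
    (hφ : ∀ x, φ (x + c) = f (φ x)) :
    ∃ (op : G → G → G) (e : G) (inv : G → G),
      (∀ a b c : G, op (op a b) c = op a (op b c)) ∧
      (∀ a : G, op e a = a) ∧ (∀ a : G, op a e = a) ∧
      (∀ a : G, op (inv a) a = e) ∧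
      Continuous (fun p : G × G => op p.1 p.2) ∧
      Continuous inv ∧
      (∃ φ : G ≃ₜ G, ∀ x y : G, φ (x + y) = op (φ x) (φ y)) ∧
      (∃ c : G, c ≠ e ∧ ∀ x : G, f x = op x c) := by
  refine ⟨fun x y => φ (φ.symm x + φ.symm y), φ 0, fun x => φ (-φ.symm x), ?_, ?_, ?_, ?_,
    by fun_prop, by fun_prop, ⟨φ, by simp⟩, φ c, fun h => hc (φ.injective h), fun x => ?_⟩
  · simp [add_assoc]
  · simp
  · simp
  · simp
  · simp [hφ]

theorem OrderIso.zpow_add_one_apply {X : Type*} [LE X] (f : X ≃o X) (n : ℤ) (x : X) :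
    (f ^ (n + 1)) x = (f ^ n) (f x) := by
  rw [zpow_add_one, RelIso.mul_apply]

theorem OrderIso.zpow_one_add_apply {X : Type*} [LE X] (f : X ≃o X) (n : ℤ) (x : X) :
    (f ^ (n + 1)) x = f ((f ^ n) x) := by
  rw [add_comm, zpow_one_add, RelIso.mul_apply]

theorem exists_zpow_apply_le_lt {f : ℝ ≃o ℝ} (hf : ∀ x, x < f x) (x₀ x : ℝ) :
    ∃ n : ℤ, (f ^ n) x₀ ≤ x ∧ x < (f ^ (n + 1)) x₀ := by
  have hmono : StrictMono fun n : ℤ => (f ^ n) x₀ := strictMono_zpow_apply (hf x₀)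
  have hup : ∃ n : ℤ, x < (f ^ n) x₀ := by
    by_contra! h
    have hlub := isLUB_ciSup (f := fun n : ℤ => (f ^ n) x₀) ⟨x, by rintro _ ⟨n, rfl⟩; exact h n⟩
    obtain ⟨_, ⟨n, rfl⟩, hn, -⟩ := hlub.exists_between (f.symm_apply_lt.2 (hf _))
    have := hlub.1 (mem_range_self (n + 1))
    simp only [OrderIso.zpow_one_add_apply] at this
    exact (f.symm_apply_lt.1 hn).not_ge this
  have hdown : ∃ n : ℤ, (f ^ n) x₀ ≤ x := by
    by_contra! h
    have hglb := isGLB_ciInf (f := fun n : ℤ => (f ^ n) x₀)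
      ⟨x, by rintro _ ⟨n, rfl⟩; exact (h n).le⟩
    obtain ⟨_, ⟨n, rfl⟩, -, hn⟩ := hglb.exists_between (hf _)
    have := f.monotone (hglb.1 (mem_range_self (n - 1)))
    rw [← OrderIso.zpow_one_add_apply, sub_add_cancel] at this
    exact hn.not_ge this
  obtain ⟨N, hN⟩ := hup
  obtain ⟨n, hn, hmax⟩ := Int.exists_greatest_of_bdd
    ⟨N, fun z hz => (hmono.lt_iff_lt.1 (lt_of_le_of_lt hz hN)).le⟩ hdown
  refine ⟨n, hn, lt_of_not_ge fun h => ?_⟩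
  have := hmax _ h
  omega

theorem exists_orderIso_add_one {f : ℝ ≃o ℝ} (hf : ∀ x, x < f x) :
    ∃ ψ : ℝ ≃o ℝ, ∀ x, ψ (x + 1) = f (ψ x) := by
  let ψ : ℝ → ℝ := fun u => (f ^ ⌊u⌋) (Int.fract u * f 0)
  have h0 := hf 0
  have hmono : StrictMono ψ := by
    intro u v huv
    rcases (Int.floor_mono huv.le).eq_or_lt with h | h
    · change (f ^ ⌊u⌋) _ < (f ^ ⌊v⌋) _
      rw [h, OrderIso.lt_iff_lt]
      have : Int.fract u < Int.fract v := by
        rw [Int.fract, Int.fract, h]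
        linarith
      gcongr
    · have hle : (f ^ (⌊u⌋ + 1)) 0 ≤ (f ^ ⌊v⌋) 0 :=
        (strictMono_zpow_apply h0).monotone (Int.add_one_le_of_lt h)
      calc ψ u < (f ^ ⌊u⌋) (f 0) :=
            (f ^ ⌊u⌋).strictMono (mul_lt_of_lt_one_left h0 (Int.fract_lt_one u))
        _ ≤ (f ^ ⌊v⌋) 0 := by rwa [← OrderIso.zpow_add_one_apply]
        _ ≤ ψ v := (f ^ ⌊v⌋).monotone (mul_nonneg (Int.fract_nonneg v) h0.le)
  have hsurj : Function.Surjective ψ := by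
    intro x
    obtain ⟨n, h1, h2⟩ := exists_zpow_apply_le_lt hf 0 x
    rw [OrderIso.zpow_add_one_apply] at h2
    have h1 : 0 ≤ (f ^ n).symm x := (f ^ n).le_symm_apply.2 h1
    have h2 : (f ^ n).symm x < f 0 := (f ^ n).symm_apply_lt.2 h2
    have hmem : (f ^ n).symm x / f 0 ∈ Ico (0 : ℝ) 1 :=
      ⟨div_nonneg h1 h0.le, (div_lt_one h0).2 h2⟩
    refine ⟨n + (f ^ n).symm x / f 0, ?_⟩
    simp only [ψ]
    rw [Int.fract_intCast_add, Int.fract_eq_self.2 hmem, Int.floor_intCast_add,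
      Int.floor_eq_zero_iff.2 hmem, add_zero, div_mul_cancel₀ _ h0.ne', OrderIso.apply_symm_apply]
  refine ⟨hmono.orderIsoOfSurjective ψ hsurj, fun x => ?_⟩
  change (f ^ ⌊x + 1⌋) (Int.fract (x + 1) * f 0) = f ((f ^ ⌊x⌋) (Int.fract x * f 0))
  rw [Int.floor_add_one, Int.fract_add_one, OrderIso.zpow_one_add_apply]

theorem exists_homeomorph_add_real {f : ℝ ≃o ℝ} (hf : ∀ x, f x ≠ x) :
    ∃ (φ : ℝ ≃ₜ ℝ) (c : ℝ), c ≠ 0 ∧ ∀ x, φ (x + c) = f (φ x) := by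
  have hsign : (∀ x, x < f x) ∨ ∀ x, f x < x := by
    by_contra! h
    obtain ⟨⟨a, ha⟩, b, hb⟩ := h
    obtain ⟨x, hx⟩ := mem_range_of_exists_le_of_exists_ge (f := fun x => f x - x) (c := 0)
      (f.continuous.sub continuous_id) ⟨a, sub_nonpos.2 ha⟩ ⟨b, sub_nonneg.2 hb⟩
    exact hf x (sub_eq_zero.1 hx)
  rcases hsign with h | h
  · obtain ⟨ψ, hψ⟩ := exists_orderIso_add_one h
    exact ⟨ψ.toHomeomorph, 1, one_ne_zero, hψ⟩
  · obtain ⟨ψ, hψ⟩ := exists_orderIso_add_one (f := f.symm) fun x => f.lt_symm_apply.2 (h x)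
    refine ⟨ψ.toHomeomorph, -1, by simp, fun x => ?_⟩
    have := hψ (x + -1)
    rw [neg_add_cancel_right] at this
    exact f.symm_apply_eq.1 this.symm

theorem orderIso_int_apply (f : ℤ ≃o ℤ) (n : ℤ) : f n = n + f 0 := by
  have h : ∀ n, f (n + 1) = f n + 1 := f.map_succ
  induction n with
  | zero => simp
  | succ n ih => rw [h, ih]; ring
  | pred n ih =>
    have := h (-n - 1)
    rw [sub_add_cancel, ih] at this
    linarith

theorem apply_eq_add_of_eq_closure {G : AddSubgroup ℝ} {a : ℝ} (ha : G = AddSubgroup.closure {a})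
    (f : G ≃o G) (hf : ∀ x, f x ≠ x) (x : G) : f x = x + f 0 := by
  have ha0 : a ≠ 0 := by
    rintro rfl
    rw [AddSubgroup.closure_singleton_zero] at ha
    subst ha
    exact hf 0 (Subsingleton.elim _ _)
  obtain ⟨b, hb0, hb⟩ : ∃ b : ℝ, 0 < b ∧ ∀ x, x ∈ G ↔ ∃ n : ℤ, n • b = x := by
    refine ⟨|a|, abs_pos.2 ha0, fun x => ?_⟩
    rw [ha, AddSubgroup.mem_closure_singleton]
    rcases abs_choice a with h | h <;> rw [h]
    exact ⟨fun ⟨n, hn⟩ => ⟨-n, by simpa using hn⟩, fun ⟨n, hn⟩ => ⟨-n, by simpa using hn⟩⟩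
  let i : ℤ → G := fun n => ⟨n • b, (hb _).2 ⟨n, rfl⟩⟩
  have himono : StrictMono i := fun m n h => zsmul_lt_zsmul_left hb0 h
  have hisurj : Function.Surjective i := fun ⟨x, hx⟩ => by
    obtain ⟨n, hn⟩ := (hb x).1 hx
    exact ⟨n, Subtype.ext hn⟩
  let e := himono.orderIsoOfSurjective i hisurj
  have hadd : ∀ m n, e (m + n) = e m + e n := fun m n => Subtype.ext (add_zsmul b m n)
  have h0 : e 0 = 0 := Subtype.ext (zero_zsmul b)
  obtain ⟨n, rfl⟩ := e.surjective x
  have := congrArg e (orderIso_int_apply ((e.trans f).trans e.symm) n)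
  rwa [hadd, OrderIso.trans_apply, OrderIso.trans_apply, OrderIso.trans_apply,
    OrderIso.trans_apply, OrderIso.apply_symm_apply, OrderIso.apply_symm_apply, h0] at this

theorem AddSubgroup.exists_notMem_between {G : AddSubgroup ℝ} (hd : Dense (G : Set ℝ))
    (hG : G ≠ ⊤) {x y : ℝ} (hxy : x < y) : ∃ t, x < t ∧ t < y ∧ t ∉ G := by
  obtain ⟨r, hr⟩ : ∃ r, r ∉ G := by
    by_contra! h
    exact hG ((AddSubgroup.eq_top_iff' G).2 h)
  obtain ⟨g, hg, h1, h2⟩ := hd.exists_between (sub_lt_sub_right hxy r)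
  exact ⟨g + r, by linarith, by linarith, fun h => hr ((G.add_mem_cancel_left hg).1 h)⟩

theorem exists_homeomorph_add_of_dense {G : AddSubgroup ℝ} [SigmaCompactSpace G]
    (hd : Dense (G : Set ℝ)) (hG : G ≠ ⊤) {f : G ≃o G} (hf : ∀ x, f x ≠ x) :
    ∃ (φ : G ≃ₜ G) (c : G), c ≠ 0 ∧ ∀ x, φ (x + c) = f (φ x) := by
  have : OrderTopology G := induced_orderTopology Subtype.val Iff.rfl fun h => by
    obtain ⟨z, hz, hz'⟩ := hd.exists_between h
    exact ⟨⟨z, hz⟩, hz'⟩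
  have : DenselyOrdered G := ⟨fun a b hab => by
    obtain ⟨z, hz, h1, h2⟩ := hd.exists_between (x := (a : ℝ)) (y := b) hab
    exact ⟨⟨z, hz⟩, h1, h2⟩⟩
  have hcut : ∀ x y : G, x < y → ∃ U : Set G, IsClopen U ∧ IsUpperSet U ∧ x ∉ U ∧ y ∈ U := by
    intro x y hxy
    obtain ⟨t, h1, h2, ht⟩ := G.exists_notMem_between hd hG (x := x) (y := y) hxy
    refine ⟨{z | t < z}, ⟨?_, isOpen_lt continuous_const continuous_subtype_val⟩,
      fun a b hab (ha : t < a) => ha.trans_le (b := (a : ℝ)) hab, h1.not_gt, h2⟩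
    have : {z : G | t < z} = {z : G | t ≤ z} := by
      ext z
      exact ⟨fun h : t < z => h.le, fun h : t ≤ z => lt_of_le_of_ne h fun h' : t = z => ht (h' ▸ z.2)⟩
    rw [this]
    exact isClosed_le continuous_const continuous_subtype_val
  obtain ⟨c, hcG, hc0, -⟩ := hd.exists_between (zero_lt_one (α := ℝ))
  let c : G := ⟨c, hcG⟩
  have hc : c ≠ 0 := fun h => hc0.ne' (congrArg Subtype.val h)
  have : Nontrivial G := ⟨c, 0, hc⟩
  have hiso : ∀ A : Set G, A.OrdConnected → IsOpen A → A.Nonempty → Nonempty (G ≃o A) := by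
    intro A hA hAo hAn
    obtain ⟨e⟩ := nonempty_orderIso_of_isOpen (exists_notMem_of_isCompact hcut) univ A
      isOpen_univ hAo univ_nonempty hAn
    exact ⟨OrderIso.Set.univ.symm.trans e⟩
  obtain ⟨φ, hφ⟩ := exists_homeomorph_semiconj hf (g := OrderIso.addRight c)
    (fun x => by simpa using hc) hcut hiso
  exact ⟨φ, c, hc, hφ⟩

theorem exists_homeomorph_add {G : AddSubgroup ℝ} [SigmaCompactSpace G] {f : G ≃o G}
    (hf : ∀ x, f x ≠ x) : ∃ (φ : G ≃ₜ G) (c : G), c ≠ 0 ∧ ∀ x, φ (x + c) = f (φ x) := by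
  rcases G.dense_or_cyclic with hd | ⟨a, ha⟩
  · rcases eq_or_ne G ⊤ with rfl | hG
    · let e : (⊤ : AddSubgroup ℝ) ≃o ℝ := OrderIso.Set.univ
      let E : (⊤ : AddSubgroup ℝ) ≃ₜ ℝ := Homeomorph.Set.univ ℝ
      obtain ⟨φ, c, hc, hφ⟩ := exists_homeomorph_add_real (f := (e.symm.trans f).trans e)
        fun x hx => hf (e.symm x) (e.symm_apply_eq.2 hx.symm).symm
      refine ⟨(E.trans φ).trans E.symm, E.symm c, fun h => hc (congrArg E h), fun x => ?_⟩
      exact congrArg E.symm (hφ (E x))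
    · exact exists_homeomorph_add_of_dense hd hG hf
  · have h := apply_eq_add_of_eq_closure ha f hf
    exact ⟨Homeomorph.refl G, f 0, hf 0, fun x => (h x).symm⟩

/-- Any fixed-point free monotonic (strictly increasing) bijection on a
σ-compact subgroup G of ℝ is a shift with respect to some group operation on G making it
a topological group topologically isomorphic to (G, +). -/
theorem stmt_1 (G : AddSubgroup ℝ) (hσ : SigmaCompactSpace G)
    (f : G → G) (hmono : StrictMono f) (hbij : Function.Bijective f)
    (hfpf : ∀ x : G, f x ≠ x) :
    ∃ (op : G → G → G) (e : G) (inv : G → G),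
      (∀ a b c : G, op (op a b) c = op a (op b c)) ∧
      (∀ a : G, op e a = a) ∧ (∀ a : G, op a e = a) ∧
      (∀ a : G, op (inv a) a = e) ∧
      Continuous (fun p : G × G => op p.1 p.2) ∧
      Continuous inv ∧
      (∃ φ : G ≃ₜ G, ∀ x y : G, φ (x + y) = op (φ x) (φ y)) ∧
      (∃ c : G, c ≠ e ∧ ∀ x : G, f x = op x c) := by
  let F := hmono.orderIsoOfSurjective f hbij.surjective
  obtain ⟨φ, c, hc, hφ⟩ := exists_homeomorph_add (f := F) hfpf
  exact exists_op_of_homeomorph φ hc hφ
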